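/- Let K be a number field and F ∈ K[x] irreducible of degree > 1. Then the set S_F of primes 𝔭 of K such that F has a root in K_𝔭 has Dirichlet density strictly less than 1. -/

import Mathlib

open Polynomial NumberField IsDedekindDomain Filter

/-- `S` has Dirichlet density `δ`:
`δ = lim_{s→1⁺} (∑_{𝔭 ∈ S} N(𝔭)^{-s}) / (-log (s-1))`. -/
noncomputable def HasDirichletDensity (K : Type*) [Field K] [NumberField K]
    (S : Set (HeightOneSpectrum (𝓞 K))) (δ : ℝ) : Prop :=
  Tendsto (fun s : ℝ =>
      (∑' v : S, (Ideal.absNorm (v.1.asIdeal) : ℝ) ^ (-s)) / (-Real.log (s - 1)))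
    (nhdsWithin 1 (Set.Ioi 1)) (nhds δ)

section IdealSums

variable {K : Type*} [Field K] [NumberField K]

theorem HeightOneSpectrum.dvd_finset_prod_iff {R : Type*} [CommRing R] [IsDedekindDomain R]
    (A : Finset (HeightOneSpectrum R)) (v : HeightOneSpectrum R) :
    v.asIdeal ∣ ∏ w ∈ A, w.asIdeal ↔ v ∈ A := by
  rw [v.prime.dvd_finsetProd_iff]
  refine ⟨fun ⟨w, hw, h⟩ => ?_, fun h => ⟨v, h, dvd_rfl⟩⟩
  have : v = w := HeightOneSpectrum.ext
    (w.isMaximal.eq_of_le v.isPrime.ne_top (Ideal.le_of_dvd h)).symm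
  exact this ▸ hw

theorem prod_one_add_absNorm_le_tsum {s : ℝ}
    (hsum : Summable fun I : Ideal (𝓞 K) => (Ideal.absNorm I : ℝ) ^ (-s))
    (A : Finset (HeightOneSpectrum (𝓞 K))) :
    ∏ v ∈ A, (1 + (Ideal.absNorm v.asIdeal : ℝ) ^ (-s)) ≤
      ∑' I : Ideal (𝓞 K), (Ideal.absNorm I : ℝ) ^ (-s) := by
  classical
  rw [Finset.prod_one_add]
  have hinj : Function.Injective
      (fun B : Finset (HeightOneSpectrum (𝓞 K)) => ∏ v ∈ B, v.asIdeal) := by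
    intro B C h
    ext v
    rw [← HeightOneSpectrum.dvd_finset_prod_iff, ← HeightOneSpectrum.dvd_finset_prod_iff]
    exact Iff.of_eq (congrArg _ h)
  calc ∑ B ∈ A.powerset, ∏ v ∈ B, (Ideal.absNorm v.asIdeal : ℝ) ^ (-s)
      = ∑ I ∈ A.powerset.image (fun B => ∏ v ∈ B, v.asIdeal), (Ideal.absNorm I : ℝ) ^ (-s) := by
        rw [Finset.sum_image (fun _ _ _ _ h => hinj h)]
        refine Finset.sum_congr rfl fun B _ => ?_
        rw [map_prod, Nat.cast_prod, Real.finsetProd_rpow _ _ fun _ _ => Nat.cast_nonneg _]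
    _ ≤ _ := hsum.sum_le_tsum _ fun _ _ => by positivity

theorem Ideal.exists_eq_finset_prod_pow {R : Type*} [CommRing R] [IsDedekindDomain R]
    {I : Ideal R} (hI : I ≠ 0) :
    ∃ e : HeightOneSpectrum R → ℕ, ∀ A : Finset (HeightOneSpectrum R),
      (∀ v : HeightOneSpectrum R, v.asIdeal ∣ I → v ∈ A) → I = ∏ v ∈ A, v.asIdeal ^ e v := by
  classical
  refine ⟨fun v => (Associates.mk v.asIdeal).count (Associates.mk I).factors, fun A hA => ?_⟩
  conv_lhs => rw [← Ideal.finprod_heightOneSpectrum_factorization hI]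
  rw [finprod_eq_prod_of_mulSupport_subset (s := A)]
  · refine Finset.prod_congr rfl fun v _ => ?_
    rw [HeightOneSpectrum.maxPowDividing]
  · intro v hv
    refine hA v ?_
    rw [Function.mem_mulSupport, HeightOneSpectrum.maxPowDividing] at hv
    by_contra h
    have := (not_congr (Associates.count_ne_zero_iff_dvd hI v.irreducible)).mpr h
    rw [not_not] at this
    rw [this] at hv
    exact hv (pow_zero _)

theorem sum_absNorm_le_prod {s : ℝ} (hs : 0 < s) (T : Finset (Ideal (𝓞 K))) :
    ∃ A : Finset (HeightOneSpectrum (𝓞 K)),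
      ∑ I ∈ T, (Ideal.absNorm I : ℝ) ^ (-s) ≤
        ∏ v ∈ A, (1 - (Ideal.absNorm v.asIdeal : ℝ) ^ (-s))⁻¹ := by
  classical
  let T' := T.filter (· ≠ 0)
  let A := T'.attach.biUnion
    fun I => (Ideal.finite_factors (I := I.1) (Finset.mem_filter.mp I.2).2).toFinset
  have hex (I : Ideal (𝓞 K)) : ∃ e : HeightOneSpectrum (𝓞 K) → ℕ, I ≠ 0 →
      ∀ A : Finset (HeightOneSpectrum (𝓞 K)),
        (∀ v : HeightOneSpectrum (𝓞 K), v.asIdeal ∣ I → v ∈ A) →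
          I = ∏ v ∈ A, v.asIdeal ^ e v := by
    by_cases hI : I = 0
    · exact ⟨0, fun h => absurd hI h⟩
    · obtain ⟨e, he⟩ := Ideal.exists_eq_finset_prod_pow hI
      exact ⟨e, fun _ => he⟩
  choose c hc using hex
  have hT' (I) (hI : I ∈ T') : I = ∏ v ∈ A, v.asIdeal ^ c I v := by
    refine hc I (Finset.mem_filter.mp hI).2 A fun v hv => ?_
    exact Finset.mem_biUnion.mpr ⟨⟨I, hI⟩, Finset.mem_attach _ _, by simpa using hv⟩
  let N := ∑ I ∈ T', ∑ v ∈ A, c I v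
  have hN (I) (hI : I ∈ T') (v) (hv : v ∈ A) : c I v ≤ N :=
    (Finset.single_le_sum (f := fun v => c I v) (fun _ _ => Nat.zero_le _) hv).trans
      (Finset.single_le_sum (f := fun I => ∑ v ∈ A, c I v) (fun _ _ => Nat.zero_le _) hI)
  refine ⟨A, ?_⟩
  have h0 : ∑ I ∈ T, (Ideal.absNorm I : ℝ) ^ (-s) = ∑ I ∈ T', (Ideal.absNorm I : ℝ) ^ (-s) := by
    rw [Finset.sum_filter]
    refine Finset.sum_congr rfl fun I _ => ?_
    split_ifs with h
    · rfl
    · rw [not_not] at h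
      simp [h, Real.zero_rpow (neg_ne_zero.mpr hs.ne')]
  have h1 (v : HeightOneSpectrum (𝓞 K)) : (Ideal.absNorm v.asIdeal : ℝ) ^ (-s) < 1 :=
    Real.rpow_lt_one_of_one_lt_of_neg (mod_cast HeightOneSpectrum.one_lt_absNorm v)
      (neg_neg_of_pos hs)
  rw [h0]
  calc ∑ I ∈ T', (Ideal.absNorm I : ℝ) ^ (-s)
      = ∑ e ∈ T'.image (fun I (v : A) => c I v),
          ∏ v : A, ((Ideal.absNorm v.1.asIdeal : ℝ) ^ (-s)) ^ (e v) := by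
        rw [Finset.sum_image]
        · refine Finset.sum_congr rfl fun I hI => ?_
          conv_lhs => rw [hT' I hI]
          rw [map_prod, Nat.cast_prod, ← Real.finsetProd_rpow _ _ fun _ _ => Nat.cast_nonneg _,
            ← Finset.prod_coe_sort]
          refine Finset.prod_congr rfl fun v _ => ?_
          rw [map_pow, Nat.cast_pow, ← Real.rpow_natCast, ← Real.rpow_natCast,
            ← Real.rpow_mul (Nat.cast_nonneg _), ← Real.rpow_mul (Nat.cast_nonneg _), mul_comm]
        · intro I hI J hJ h
          rw [hT' I hI, hT' J hJ]
          exact Finset.prod_congr rfl fun v hv => by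
            rw [show c I v = c J v from congrFun h ⟨v, hv⟩]
    _ ≤ ∑ e ∈ Fintype.piFinset (fun _ : A => Finset.range (N + 1)),
          ∏ v : A, ((Ideal.absNorm v.1.asIdeal : ℝ) ^ (-s)) ^ (e v) := by
        refine Finset.sum_le_sum_of_subset_of_nonneg ?_ fun _ _ _ => by positivity
        intro e he
        obtain ⟨I, hI, rfl⟩ := Finset.mem_image.mp he
        rw [Fintype.mem_piFinset]
        exact fun v => Finset.mem_range_succ_iff.mpr (hN I hI v v.2)
    _ = ∏ v : A, ∑ j ∈ Finset.range (N + 1), ((Ideal.absNorm v.1.asIdeal : ℝ) ^ (-s)) ^ j :=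
        (Finset.prod_univ_sum _ _).symm
    _ ≤ ∏ v : A, (1 - (Ideal.absNorm v.1.asIdeal : ℝ) ^ (-s))⁻¹ := by
        refine Finset.prod_le_prod (fun _ _ => by positivity) fun v _ => ?_
        rw [← tsum_geometric_of_lt_one (by positivity) (h1 v)]
        exact (summable_geometric_of_lt_one (by positivity) (h1 v)).sum_le_tsum _
          fun _ _ => by positivity
    _ = _ := Finset.prod_coe_sort A fun v => (1 - (Ideal.absNorm v.asIdeal : ℝ) ^ (-s))⁻¹

theorem Real.exp_sub_sq_le_one_add {x : ℝ} (hx : 0 ≤ x) :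
    Real.exp (x - x ^ 2) ≤ 1 + x := by
  have h1 : 0 < 1 + x := by linarith
  rw [← Real.le_log_iff_exp_le h1]
  have := Real.one_sub_inv_le_log_of_pos h1
  refine le_trans ?_ this
  rw [le_sub_iff_add_le, ← le_sub_iff_add_le', inv_le_iff_one_le_mul₀ h1]
  nlinarith [pow_nonneg hx 3]

theorem Real.inv_one_sub_le_exp {x : ℝ} (h : x ≤ 1 / 2) :
    (1 - x)⁻¹ ≤ Real.exp (x + 2 * x ^ 2) := by
  have h1 : 0 < 1 - x := by linarith
  rw [inv_le_comm₀ h1 (Real.exp_pos _), ← Real.exp_neg, ← Real.le_log_iff_exp_le h1]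
  refine le_trans ?_ (Real.one_sub_inv_le_log_of_pos h1)
  rw [le_sub_iff_add_le, ← le_sub_iff_add_le', inv_le_iff_one_le_mul₀ h1]
  nlinarith [mul_nonneg (sq_nonneg x) (sub_nonneg.mpr h)]

theorem absNorm_rpow_le_half {s : ℝ} (hs : 1 ≤ s) (v : HeightOneSpectrum (𝓞 K)) :
    (Ideal.absNorm v.asIdeal : ℝ) ^ (-s) ≤ 1 / 2 := by
  have h2 : (2 : ℝ) ≤ Ideal.absNorm v.asIdeal := mod_cast HeightOneSpectrum.one_lt_absNorm v
  calc (Ideal.absNorm v.asIdeal : ℝ) ^ (-s) ≤ (Ideal.absNorm v.asIdeal : ℝ) ^ (-1 : ℝ) :=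
        Real.rpow_le_rpow_of_exponent_le (by linarith) (by linarith)
    _ ≤ 1 / 2 := by
        rw [Real.rpow_neg_one, one_div]
        exact inv_anti₀ two_pos h2

theorem HeightOneSpectrum.summable_absNorm_rpow {s : ℝ}
    (hsum : Summable fun I : Ideal (𝓞 K) => (Ideal.absNorm I : ℝ) ^ (-s)) :
    Summable fun v : HeightOneSpectrum (𝓞 K) => (Ideal.absNorm v.asIdeal : ℝ) ^ (-s) :=
  hsum.comp_injective (i := HeightOneSpectrum.asIdeal) fun _ _ h => HeightOneSpectrum.ext h

theorem abs_tsum_sub_log_le {s : ℝ} (hs : 1 ≤ s)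
    (hsum : Summable fun I : Ideal (𝓞 K) => (Ideal.absNorm I : ℝ) ^ (-s))
    (hsq : Summable fun v : HeightOneSpectrum (𝓞 K) => (Ideal.absNorm v.asIdeal : ℝ) ^ (-2 : ℝ)) :
    |∑' v : HeightOneSpectrum (𝓞 K), (Ideal.absNorm v.asIdeal : ℝ) ^ (-s) -
      Real.log (∑' I : Ideal (𝓞 K), (Ideal.absNorm I : ℝ) ^ (-s))| ≤
      2 * ∑' v : HeightOneSpectrum (𝓞 K), (Ideal.absNorm v.asIdeal : ℝ) ^ (-2 : ℝ) := by
  have hx := HeightOneSpectrum.summable_absNorm_rpow hsum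
  have hpos : 0 < ∑' I : Ideal (𝓞 K), (Ideal.absNorm I : ℝ) ^ (-s) :=
    hsum.tsum_pos (fun _ => by positivity) ⊤ (by simp)
  have hle (v : HeightOneSpectrum (𝓞 K)) :
      ((Ideal.absNorm v.asIdeal : ℝ) ^ (-s)) ^ 2 ≤ (Ideal.absNorm v.asIdeal : ℝ) ^ (-2 : ℝ) := by
    rw [← Real.rpow_natCast, ← Real.rpow_mul (Nat.cast_nonneg _)]
    refine Real.rpow_le_rpow_of_exponent_le ?_ (by push_cast; linarith)
    exact_mod_cast (HeightOneSpectrum.one_lt_absNorm v).le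
  have hC : 0 ≤ ∑' v : HeightOneSpectrum (𝓞 K), (Ideal.absNorm v.asIdeal : ℝ) ^ (-2 : ℝ) :=
    tsum_nonneg fun _ => by positivity
  rw [abs_le]
  constructor
  · rw [le_sub_iff_add_le, ← le_sub_iff_add_le', sub_neg_eq_add, Real.log_le_iff_le_exp hpos]
    refine hsum.tsum_le_of_sum_le fun T => ?_
    obtain ⟨A, hA⟩ := sum_absNorm_le_prod (zero_lt_one.trans_le hs) T
    refine hA.trans ?_
    calc ∏ v ∈ A, (1 - (Ideal.absNorm v.asIdeal : ℝ) ^ (-s))⁻¹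
        ≤ ∏ v ∈ A, Real.exp ((Ideal.absNorm v.asIdeal : ℝ) ^ (-s) +
            2 * (Ideal.absNorm v.asIdeal : ℝ) ^ (-2 : ℝ)) := by
          refine Finset.prod_le_prod (fun v _ => ?_) fun v _ => ?_
          · have := absNorm_rpow_le_half hs v
            exact inv_nonneg.mpr (by linarith)
          · refine (Real.inv_one_sub_le_exp (absNorm_rpow_le_half hs v)).trans ?_
            have := hle v
            gcongr
      _ = Real.exp (∑ v ∈ A, ((Ideal.absNorm v.asIdeal : ℝ) ^ (-s) +
            2 * (Ideal.absNorm v.asIdeal : ℝ) ^ (-2 : ℝ))) := (Real.exp_sum _ _).symm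
      _ ≤ _ := by
          rw [Real.exp_le_exp, ← tsum_mul_left, ← hx.tsum_add (hsq.mul_left 2)]
          exact (hx.add (hsq.mul_left 2)).sum_le_tsum _ fun _ _ => by positivity
  · suffices h : ∑' v : HeightOneSpectrum (𝓞 K), (Ideal.absNorm v.asIdeal : ℝ) ^ (-s) -
        ∑' v : HeightOneSpectrum (𝓞 K), (Ideal.absNorm v.asIdeal : ℝ) ^ (-2 : ℝ) ≤
        Real.log (∑' I : Ideal (𝓞 K), (Ideal.absNorm I : ℝ) ^ (-s)) by linarith
    rw [← hx.tsum_sub hsq]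
    refine (hx.sub hsq).tsum_le_of_sum_le fun A => ?_
    rw [Real.le_log_iff_exp_le hpos, Real.exp_sum]
    refine le_trans (Finset.prod_le_prod (fun _ _ => (Real.exp_pos _).le) fun v _ => ?_)
      (prod_one_add_absNorm_le_tsum hsum A)
    refine le_trans (Real.exp_le_exp.mpr ?_) (Real.exp_sub_sq_le_one_add (by positivity))
    have := hle v
    linarith

theorem hasSum_absNorm_fiber (s : ℝ) (hs : s ≠ 0) (n : ℕ) :
    HasSum (fun I : (Ideal.absNorm : Ideal (𝓞 K) → ℕ) ⁻¹' {n} => (Ideal.absNorm I.1 : ℝ) ^ (-s))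
      (LSeries.term (fun n => (Nat.card {I : Ideal (𝓞 K) // Ideal.absNorm I = n} : ℂ)) s n).re := by
  have : Finite ((Ideal.absNorm : Ideal (𝓞 K) → ℕ) ⁻¹' {n}) :=
    Ideal.finite_setOfPred_absNorm_eq n
  have := Fintype.ofFinite ((Ideal.absNorm : Ideal (𝓞 K) → ℕ) ⁻¹' {n})
  convert hasSum_fintype _ using 1
  rw [Finset.sum_congr rfl fun I _ => by rw [show Ideal.absNorm I.1 = n from I.2]]
  rw [Finset.sum_const, LSeries.term_def, Finset.card_univ, ← Nat.card_eq_fintype_card]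
  split_ifs with h
  · simp [h, Real.zero_rpow (neg_ne_zero.mpr hs)]
  · have : (n : ℂ) ^ (s : ℂ) = ((n : ℝ) ^ s : ℝ) := by
      rw [Complex.ofReal_cpow (Nat.cast_nonneg _), Complex.ofReal_natCast]
    rw [this, Real.rpow_neg (Nat.cast_nonneg _), nsmul_eq_mul, ← div_eq_mul_inv]
    norm_cast

theorem summable_absNorm_of_LSeriesSummable {s : ℝ} (hs : s ≠ 0)
    (h : LSeriesSummable (fun n => (Nat.card {I : Ideal (𝓞 K) // Ideal.absNorm I = n} : ℂ)) s) :
    Summable fun I : Ideal (𝓞 K) => (Ideal.absNorm I : ℝ) ^ (-s) := by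
  rw [← (Equiv.sigmaFiberEquiv (Ideal.absNorm : Ideal (𝓞 K) → ℕ)).summable_iff,
    summable_sigma_of_nonneg fun _ => by simp only [Function.comp_apply]; positivity]
  refine ⟨fun n => (hasSum_absNorm_fiber s hs n).summable, ?_⟩
  refine (Complex.hasSum_re h.hasSum).summable.congr fun n => ?_
  exact (hasSum_absNorm_fiber s hs n).tsum_eq.symm

theorem dedekindZeta_re_eq_tsum {s : ℝ} (hs : s ≠ 0)
    (h : LSeriesSummable (fun n => (Nat.card {I : Ideal (𝓞 K) // Ideal.absNorm I = n} : ℂ)) s) :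
    (dedekindZeta K s).re = ∑' I : Ideal (𝓞 K), (Ideal.absNorm I : ℝ) ^ (-s) := by
  have h1 := (summable_absNorm_of_LSeriesSummable hs h).hasSum.tsum_fiberwise
    (Ideal.absNorm : Ideal (𝓞 K) → ℕ)
  have h2 := Complex.hasSum_re h.hasSum
  simp only [(hasSum_absNorm_fiber s hs _).tsum_eq] at h1
  exact h2.unique h1

variable (K) in
theorem eventually_LSeriesSummable_nhdsGT :
    ∀ᶠ s : ℝ in nhdsWithin 1 (Set.Ioi 1),
      LSeriesSummable (fun n => (Nat.card {I : Ideal (𝓞 K) // Ideal.absNorm I = n} : ℂ)) s := by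
  have h := (tendsto_sub_one_mul_dedekindZeta_nhdsGT K).eventually_ne
    (Complex.ofReal_ne_zero.mpr (dedekindZeta_residue_ne_zero K))
  filter_upwards [h] with s hs
  by_contra h'
  refine hs ?_
  rw [dedekindZeta, LSeries, tsum_eq_zero_of_not_summable h', mul_zero]

variable (K) in
theorem summable_absNorm_rpow {s : ℝ} (hs : 1 < s) :
    Summable fun I : Ideal (𝓞 K) => (Ideal.absNorm I : ℝ) ^ (-s) := by
  have h1 : ∀ᶠ t : ℝ in nhdsWithin 1 (Set.Ioi 1), t ∈ Set.Ioo 1 s :=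
    Ioo_mem_nhdsGT hs
  obtain ⟨t, ht, ht1, hts⟩ := ((eventually_LSeriesSummable_nhdsGT K).and h1).exists
  refine (summable_absNorm_of_LSeriesSummable (by linarith) ht).of_nonneg_of_le
    (fun _ => by positivity) fun I => ?_
  rcases (Ideal.absNorm I).eq_zero_or_pos with h | h
  · simp [h, Real.zero_rpow (show -s ≠ 0 by linarith), Real.zero_rpow (show -t ≠ 0 by linarith)]
  · exact Real.rpow_le_rpow_of_exponent_le (mod_cast h) (by linarith)

variable (K) in
theorem HeightOneSpectrum.summable_absNorm_rpow_of_one_lt {s : ℝ} (hs : 1 < s) :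
    Summable fun v : HeightOneSpectrum (𝓞 K) => (Ideal.absNorm v.asIdeal : ℝ) ^ (-s) :=
  HeightOneSpectrum.summable_absNorm_rpow (_root_.summable_absNorm_rpow K hs)

theorem tendsto_neg_log_sub_one_atTop :
    Tendsto (fun s : ℝ => -Real.log (s - 1)) (nhdsWithin 1 (Set.Ioi 1)) atTop := by
  refine tendsto_neg_atBot_atTop.comp (Real.tendsto_log_nhdsGT_zero.comp ?_)
  refine tendsto_nhdsWithin_iff.mpr ⟨?_, ?_⟩
  · have : Tendsto (fun s : ℝ => s - 1) (nhds 1) (nhds (1 - 1)) :=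
      (continuous_sub_right 1).tendsto 1
    rw [sub_self] at this
    exact this.mono_left nhdsWithin_le_nhds
  · filter_upwards [self_mem_nhdsWithin] with s hs
    exact sub_pos.mpr (Set.mem_Ioi.mp hs)

theorem tendsto_div_neg_log_of_abs_sub_le {u w : ℝ → ℝ} {a C : ℝ}
    (hw : Tendsto (fun s => w s / (-Real.log (s - 1))) (nhdsWithin 1 (Set.Ioi 1)) (nhds a))
    (h : ∀ᶠ s in nhdsWithin 1 (Set.Ioi 1), |u s - w s| ≤ C) :
    Tendsto (fun s => u s / (-Real.log (s - 1))) (nhdsWithin 1 (Set.Ioi 1)) (nhds a) := by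
  have h0 : Tendsto (fun s => (u s - w s) / (-Real.log (s - 1)))
      (nhdsWithin 1 (Set.Ioi 1)) (nhds 0) := by
    refine squeeze_zero_norm' ?_ (tendsto_neg_log_sub_one_atTop.const_div_atTop C)
    filter_upwards [h, tendsto_neg_log_sub_one_atTop.eventually_gt_atTop 0] with s hs hl
    rw [norm_div, Real.norm_eq_abs, Real.norm_eq_abs, abs_of_pos hl]
    exact div_le_div_of_nonneg_right hs hl.le
  have := hw.add h0
  rw [add_zero] at this
  refine this.congr fun s => ?_
  rw [← add_div, add_sub_cancel]

variable (K) in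
theorem tendsto_tsum_absNorm_div_neg_log :
    Tendsto (fun s : ℝ => (∑' v : HeightOneSpectrum (𝓞 K), (Ideal.absNorm v.asIdeal : ℝ) ^ (-s)) /
      (-Real.log (s - 1))) (nhdsWithin 1 (Set.Ioi 1)) (nhds 1) := by
  have hlim : Tendsto (fun s : ℝ => Real.log ((s - 1) * ∑' I : Ideal (𝓞 K),
      (Ideal.absNorm I : ℝ) ^ (-s))) (nhdsWithin 1 (Set.Ioi 1))
      (nhds (Real.log (dedekindZeta_residue K))) := by
    refine Tendsto.log ?_ (dedekindZeta_residue_ne_zero K)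
    have := (Complex.continuous_re.tendsto _).comp (tendsto_sub_one_mul_dedekindZeta_nhdsGT K)
    refine Tendsto.congr' ?_ this
    filter_upwards [eventually_LSeriesSummable_nhdsGT K, self_mem_nhdsWithin] with s h hs
    rw [← dedekindZeta_re_eq_tsum (zero_lt_one.trans hs).ne' h, Function.comp_apply,
      ← Complex.ofReal_one, ← Complex.ofReal_sub, Complex.re_ofReal_mul]
  refine tendsto_div_neg_log_of_abs_sub_le (w := fun s => -Real.log (s - 1)) (a := 1)
    (C := 2 * ∑' v : HeightOneSpectrum (𝓞 K), (Ideal.absNorm v.asIdeal : ℝ) ^ (-2 : ℝ) +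
      (|Real.log (dedekindZeta_residue K)| + 1)) ?_ ?_
  · refine tendsto_const_nhds.congr' ?_
    filter_upwards [tendsto_neg_log_sub_one_atTop.eventually_gt_atTop 0] with s hl
    rw [div_self hl.ne']
  · filter_upwards [self_mem_nhdsWithin, hlim.abs.eventually_lt_const (lt_add_one _)] with s hs hl
    have hs' : 1 < s := hs
    have hsum := summable_absNorm_rpow K hs'
    have hpos : 0 < ∑' I : Ideal (𝓞 K), (Ideal.absNorm I : ℝ) ^ (-s) :=
      hsum.tsum_pos (fun _ => by positivity) ⊤ (by simp)
    rw [Real.log_mul (sub_pos.mpr hs').ne' hpos.ne'] at hl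
    have h2 := abs_tsum_sub_log_le hs'.le hsum
      (HeightOneSpectrum.summable_absNorm_rpow_of_one_lt K one_lt_two)
    refine le_trans (le_of_eq ?_) ((abs_add_le _ _).trans (add_le_add h2 hl.le))
    congr 1
    ring

end IdealSums

section Hensel

variable {K : Type*} [Field K] [NumberField K] (v : HeightOneSpectrum (𝓞 K))

theorem HeightOneSpectrum.mem_maximalIdeal_pow_iff_norm_le {π : v.adicCompletionIntegers K}
    (hπ : Irreducible π) (n : ℕ) (x : v.adicCompletionIntegers K) :
    x ∈ IsLocalRing.maximalIdeal (v.adicCompletionIntegers K) ^ n ↔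
      ‖(x : v.adicCompletion K)‖ ≤ ‖(π : v.adicCompletion K)‖ ^ n := by
  rw [hπ.maximalIdeal_eq, Ideal.span_singleton_pow, Ideal.mem_span_singleton,
    (HeightOneSpectrum.adicCompletionIntegers.integers v (K := K)).dvd_iff_le, ← norm_pow,
    Valued.toNormedField.norm_le_iff]
  simp

theorem HeightOneSpectrum.norm_lt_one_of_irreducible {π : v.adicCompletionIntegers K}
    (hπ : Irreducible π) : ‖(π : v.adicCompletion K)‖ < 1 := by
  rw [Valued.toNormedField.norm_lt_one_iff]
  refine lt_of_le_of_ne π.2 fun h => hπ.1 ?_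
  exact HeightOneSpectrum.adicCompletionIntegers.isUnit_iff_valued_eq_one.mpr h

instance HeightOneSpectrum.isAdicComplete_adicCompletionIntegers :
    IsAdicComplete (IsLocalRing.maximalIdeal (v.adicCompletionIntegers K))
      (v.adicCompletionIntegers K) where
  haus' := by
    have : IsHausdorff (IsLocalRing.maximalIdeal (v.adicCompletionIntegers K))
      (v.adicCompletionIntegers K) := inferInstance
    exact this.haus'
  prec' f hf := by
    obtain ⟨π, hπ⟩ := IsDiscreteValuationRing.exists_irreducible (v.adicCompletionIntegers K)
    have hr := HeightOneSpectrum.norm_lt_one_of_irreducible v hπ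
    simp only [SModEq.sub_mem, smul_eq_mul, Ideal.mul_top,
      HeightOneSpectrum.mem_maximalIdeal_pow_iff_norm_le v hπ] at hf ⊢
    push_cast at hf ⊢
    have hc : CauchySeq (fun n => (f n : v.adicCompletion K)) := by
      refine cauchySeq_of_le_geometric _ 1 hr fun n => ?_
      rw [dist_eq_norm, one_mul]
      exact hf (Nat.le_succ n)
    obtain ⟨L, hL⟩ := cauchySeq_tendsto_of_complete hc
    have hL1 : ‖L‖ ≤ 1 := le_of_tendsto hL.norm
      (Eventually.of_forall fun n => Valued.toNormedField.norm_le_one_iff.mpr (f n).2)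
    refine ⟨⟨L, Valued.toNormedField.norm_le_one_iff.mp hL1⟩, fun n => ?_⟩
    exact le_of_tendsto (hL.const_sub _).norm
      (eventually_atTop.mpr ⟨n, fun m hm => hf hm⟩)

theorem HeightOneSpectrum.exists_isRoot_of_residue {f : (v.adicCompletionIntegers K)[X]}
    (hf : f.Monic) {a : v.adicCompletionIntegers K}
    (ha : f.eval a ∈ IsLocalRing.maximalIdeal (v.adicCompletionIntegers K))
    (ha' : f.derivative.eval a ∉ IsLocalRing.maximalIdeal (v.adicCompletionIntegers K)) :
    ∃ b, f.IsRoot b ∧ b - a ∈ IsLocalRing.maximalIdeal (v.adicCompletionIntegers K) := by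
  refine HenselianRing.is_henselian f hf a ha ?_
  rw [IsLocalRing.mem_maximalIdeal, mem_nonunits_iff, not_not] at ha'
  exact ha'.map _

end Hensel

section LocalEmbeddings

variable {K : Type*} [Field K] [NumberField K] {v : HeightOneSpectrum (𝓞 K)}

theorem HeightOneSpectrum.mem_maximalIdeal_iff (x : v.adicCompletionIntegers K) :
    x ∈ IsLocalRing.maximalIdeal (v.adicCompletionIntegers K) ↔
      Valued.v (x : v.adicCompletion K) < 1 := by
  rw [IsLocalRing.mem_maximalIdeal, mem_nonunits_iff,
    HeightOneSpectrum.adicCompletionIntegers.isUnit_iff_valued_eq_one]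
  exact ⟨fun h => lt_of_le_of_ne x.2 h, fun h => h.ne⟩

theorem HeightOneSpectrum.algebraMap_mem_maximalIdeal_iff (a : 𝓞 K) :
    algebraMap (𝓞 K) (v.adicCompletionIntegers K) a ∈
      IsLocalRing.maximalIdeal (v.adicCompletionIntegers K) ↔ a ∈ v.asIdeal := by
  rw [HeightOneSpectrum.mem_maximalIdeal_iff,
    HeightOneSpectrum.algebraMap_adicCompletionIntegers_apply,
    HeightOneSpectrum.valuedAdicCompletion_eq_valuation', HeightOneSpectrum.valuation_lt_one_iff_mem]

theorem HeightOneSpectrum.exists_sub_algebraMap_mem_maximalIdeal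
    (y : v.adicCompletionIntegers K) :
    ∃ a : 𝓞 K, y - algebraMap (𝓞 K) (v.adicCompletionIntegers K) a ∈
      IsLocalRing.maximalIdeal (v.adicCompletionIntegers K) := by
  have hopen : IsOpen {z : v.adicCompletion K | Valued.v (z - (y : v.adicCompletion K)) < 1} := by
    have : {z : v.adicCompletion K | Valued.v (z - (y : v.adicCompletion K)) < 1} =
        Metric.ball (y : v.adicCompletion K) 1 := by
      ext z
      simp [dist_eq_norm, Valued.toNormedField.norm_lt_one_iff]
    rw [this]
    exact Metric.isOpen_ball
  obtain ⟨z, hz⟩ := (HeightOneSpectrum.denseRange_algebraMap (K := K) v).exists_mem_open hopen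
    ⟨y, by simp⟩
  have hz : Valued.v (algebraMap K (v.adicCompletion K) z - y) < 1 := hz
  have hz1 : v.valuation K z ≤ 1 := by
    rw [← HeightOneSpectrum.valuedAdicCompletion_eq_valuation']
    have : ((z : K) : v.adicCompletion K) =
      (algebraMap K (v.adicCompletion K) z - y) + y := by rw [sub_add_cancel]; rfl
    rw [this]
    exact (Valuation.map_add _ _ _).trans (max_le hz.le y.2)
  obtain ⟨a, ha⟩ := v.exists_valuation_sub_lt_of_integer hz1 1
  refine ⟨a, ?_⟩
  rw [HeightOneSpectrum.mem_maximalIdeal_iff]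
  have h1 : Valued.v (algebraMap K (v.adicCompletion K) (algebraMap (𝓞 K) K a - z)) < 1 := by
    have := HeightOneSpectrum.valuedAdicCompletion_eq_valuation' (v := v) (algebraMap (𝓞 K) K a - z)
    exact this.trans_lt (by simpa using ha)
  have h2 := Valuation.map_add_lt _ hz h1
  have e : ((y - algebraMap (𝓞 K) (v.adicCompletionIntegers K) a : v.adicCompletionIntegers K) :
      v.adicCompletion K) = y - algebraMap K (v.adicCompletion K) (algebraMap (𝓞 K) K a) := rfl
  rw [e, Valuation.map_sub_swap]
  convert h2 using 2
  rw [map_sub]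
  ring

instance HeightOneSpectrum.isScalarTower_adicCompletionIntegers :
    IsScalarTower (𝓞 K) (v.adicCompletionIntegers K) (v.adicCompletion K) :=
  IsScalarTower.of_algebraMap_eq fun _ => rfl

variable {M : Type*} [Field M] [Algebra K M]

/-- The restriction of an embedding of `M` in `K_v` to the rings of integers. -/
noncomputable def integerHom (h : M →ₐ[K] v.adicCompletion K) :
    𝓞 M →+* v.adicCompletionIntegers K :=
  ((h : M →+* v.adicCompletion K).comp (algebraMap (𝓞 M) M)).codRestrict
    (v.adicCompletionIntegers K) fun x => by
      have hx : IsIntegral (v.adicCompletionIntegers K) (h (algebraMap (𝓞 M) M x)) := by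
        have h1 : IsIntegral (𝓞 K) (algebraMap (𝓞 M) M x) :=
          (Algebra.IsIntegral.isIntegral (R := 𝓞 K) x).algebraMap
        have h2 : IsIntegral (𝓞 K) (h (algebraMap (𝓞 M) M x)) :=
          h1.map (h.restrictScalars (𝓞 K))
        exact h2.tower_top
      obtain ⟨y, hy⟩ := IsIntegrallyClosed.isIntegral_iff.mp hx
      exact hy ▸ y.2

theorem coe_integerHom (h : M →ₐ[K] v.adicCompletion K) (x : 𝓞 M) :
    (integerHom h x : v.adicCompletion K) = h (algebraMap (𝓞 M) M x) := rfl

theorem integerHom_algebraMap (h : M →ₐ[K] v.adicCompletion K) (a : 𝓞 K) :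
    integerHom h (algebraMap (𝓞 K) (𝓞 M) a) =
      algebraMap (𝓞 K) (v.adicCompletionIntegers K) a := by
  ext
  rw [coe_integerHom, ← IsScalarTower.algebraMap_apply, IsScalarTower.algebraMap_apply (𝓞 K) K M,
    h.commutes]
  rfl

/-- The prime of `M` induced by an embedding in `K_v`. -/
noncomputable def primeOfAlgHom (h : M →ₐ[K] v.adicCompletion K) :
    HeightOneSpectrum (𝓞 M) where
  asIdeal := (IsLocalRing.maximalIdeal (v.adicCompletionIntegers K)).comap (integerHom h)
  isPrime := inferInstance
  ne_bot hbot := by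
    obtain ⟨a, ha, ha0⟩ := Submodule.exists_mem_ne_zero_of_ne_bot v.ne_bot
    have : algebraMap (𝓞 K) (𝓞 M) a ∈
        (IsLocalRing.maximalIdeal (v.adicCompletionIntegers K)).comap (integerHom h) := by
      rw [Ideal.mem_comap, integerHom_algebraMap,
        HeightOneSpectrum.algebraMap_mem_maximalIdeal_iff]
      exact ha
    rw [hbot, Ideal.mem_bot, map_eq_zero_iff _ (FaithfulSMul.algebraMap_injective _ _)] at this
    exact ha0 this

theorem mem_primeOfAlgHom_iff (h : M →ₐ[K] v.adicCompletion K) (x : 𝓞 M) :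
    x ∈ (primeOfAlgHom h).asIdeal ↔
      integerHom h x ∈ IsLocalRing.maximalIdeal (v.adicCompletionIntegers K) := Iff.rfl

theorem under_primeOfAlgHom (h : M →ₐ[K] v.adicCompletion K) :
    (primeOfAlgHom h).under (𝓞 K) = v := by
  ext a
  rw [HeightOneSpectrum.under_asIdeal, Ideal.mem_comap, mem_primeOfAlgHom_iff,
    integerHom_algebraMap, HeightOneSpectrum.algebraMap_mem_maximalIdeal_iff]

variable (K) in
/-- A prime of `M` has residual degree one over `K` if every residue class is represented by an
integer of `K`. -/
def IsDegreeOne (P : HeightOneSpectrum (𝓞 M)) : Prop :=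
  ∀ x : 𝓞 M, ∃ a : 𝓞 K, x - algebraMap (𝓞 K) (𝓞 M) a ∈ P.asIdeal

theorem isDegreeOne_primeOfAlgHom (h : M →ₐ[K] v.adicCompletion K) :
    IsDegreeOne K (primeOfAlgHom h) := fun x => by
  obtain ⟨a, ha⟩ := HeightOneSpectrum.exists_sub_algebraMap_mem_maximalIdeal (integerHom h x)
  refine ⟨a, ?_⟩
  rwa [mem_primeOfAlgHom_iff, map_sub, integerHom_algebraMap]

theorem integerHom_aeval (h : M →ₐ[K] v.adicCompletion K) (θ : 𝓞 M) (q : (𝓞 K)[X]) :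
    integerHom h (aeval θ q) = aeval (integerHom h θ) q := by
  rw [aeval_def, hom_eval₂, aeval_def]
  congr 1
  ext a
  simp only [RingHom.comp_apply, integerHom_algebraMap]

theorem aeval_sub_mem {R S : Type*} [CommRing R] [CommRing S] [Algebra R S] (I : Ideal S)
    {x y : S} (h : x - y ∈ I) (q : R[X]) : aeval x q - aeval y q ∈ I := by
  rw [← eval_map_algebraMap, ← eval_map_algebraMap]
  exact I.mem_of_dvd (sub_dvd_eval_sub _ _ _) h

theorem eq_of_isRoot_of_sub_mem {R : Type*} [CommRing R] [IsLocalRing R] {f : R[X]} {x y : R}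
    (hx : f.IsRoot x) (hy : f.IsRoot y) (hxy : y - x ∈ IsLocalRing.maximalIdeal R)
    (hd : f.derivative.eval x ∉ IsLocalRing.maximalIdeal R) : x = y := by
  obtain ⟨k, hk⟩ := binomExpansion f x (y - x)
  rw [add_sub_cancel, hx.eq_zero, hy.eq_zero] at hk
  have hu : IsUnit (f.derivative.eval x + k * (y - x)) := by
    by_contra hc
    refine hd ((Ideal.add_mem_iff_left _ ?_).mp ((IsLocalRing.mem_maximalIdeal _).mpr hc))
    exact Ideal.mul_mem_left _ _ hxy
  have : (f.derivative.eval x + k * (y - x)) * (y - x) = 0 := by linear_combination -hk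
  exact (sub_eq_zero.mp (hu.mul_right_eq_zero.mp this)).symm

theorem algHom_eq_of_primeOfAlgHom_eq {θ : 𝓞 M}
    (hθ : Algebra.adjoin K {algebraMap (𝓞 M) M θ} = ⊤) {d : 𝓞 K} (hd : d ∉ v.asIdeal)
    (hdvd : aeval θ (derivative (minpoly (𝓞 K) θ)) ∣ algebraMap (𝓞 K) (𝓞 M) d)
    {h h' : M →ₐ[K] v.adicCompletion K} (hh : primeOfAlgHom h = primeOfAlgHom h') : h = h' := by
  obtain ⟨a, ha⟩ := isDegreeOne_primeOfAlgHom h θ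
  have ha' := hh ▸ ha
  rw [mem_primeOfAlgHom_iff, map_sub, integerHom_algebraMap] at ha ha'
  have key : integerHom h θ = integerHom h' θ := by
    refine eq_of_isRoot_of_sub_mem
      (f := (minpoly (𝓞 K) θ).map (algebraMap (𝓞 K) (v.adicCompletionIntegers K))) ?_ ?_ ?_ ?_
    · rw [IsRoot, eval_map_algebraMap, ← integerHom_aeval, minpoly.aeval, map_zero]
    · rw [IsRoot, eval_map_algebraMap, ← integerHom_aeval, minpoly.aeval, map_zero]
    · rw [← sub_sub_sub_cancel_right _ _ (algebraMap (𝓞 K) (v.adicCompletionIntegers K) a)]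
      exact Ideal.sub_mem _ ha' ha
    · rw [derivative_map, eval_map_algebraMap, ← integerHom_aeval]
      intro hmem
      apply hd
      rw [← HeightOneSpectrum.algebraMap_mem_maximalIdeal_iff, ← integerHom_algebraMap h]
      exact Ideal.mem_of_dvd _ (map_dvd _ hdvd) hmem
  refine AlgHom.ext_of_adjoin_eq_top hθ fun x hx => ?_
  rw [Set.mem_singleton_iff.mp hx, ← coe_integerHom, ← coe_integerHom, key]

variable [NumberField M]

theorem exists_primeOfAlgHom_eq {θ : 𝓞 M}
    (hθ : Algebra.adjoin K {algebraMap (𝓞 M) M θ} = ⊤) {d : 𝓞 K} (hd : d ∉ v.asIdeal)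
    (hdvd : aeval θ (derivative (minpoly (𝓞 K) θ)) ∣ algebraMap (𝓞 K) (𝓞 M) d)
    (hcond : algebraMap (𝓞 K) (𝓞 M) d ∈ conductor (𝓞 K) θ)
    {P : HeightOneSpectrum (𝓞 M)} (hP : P.under (𝓞 K) = v) (hP1 : IsDegreeOne K P) :
    ∃ h : M →ₐ[K] v.adicCompletion K, primeOfAlgHom h = P := by
  have hmem (x : 𝓞 K) : algebraMap (𝓞 K) (𝓞 M) x ∈ P.asIdeal ↔ x ∈ v.asIdeal := by
    rw [← hP, HeightOneSpectrum.under_asIdeal, Ideal.mem_comap]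
  have hdP := (hmem d).not.mpr hd
  obtain ⟨a, ha⟩ := hP1 θ
  have haeval (q : (𝓞 K)[X]) : aeval θ q ∈ P.asIdeal ↔ q.eval a ∈ v.asIdeal := by
    have h1 := aeval_sub_mem P.asIdeal ha q
    rw [aeval_algebraMap_apply, coe_aeval_eq_eval] at h1
    rw [← hmem]
    exact ⟨fun h => by simpa using sub_mem h h1, fun h => by simpa using add_mem h1 h⟩
  set f := minpoly (𝓞 K) θ with hf
  have hint : IsIntegral (𝓞 K) θ := Algebra.IsIntegral.isIntegral θ
  have hmap (q : (𝓞 K)[X]) :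
      (q.map (algebraMap (𝓞 K) (v.adicCompletionIntegers K))).eval
        (algebraMap (𝓞 K) (v.adicCompletionIntegers K) a) ∈
          IsLocalRing.maximalIdeal (v.adicCompletionIntegers K) ↔ q.eval a ∈ v.asIdeal := by
    rw [eval_map_algebraMap, aeval_algebraMap_apply, coe_aeval_eq_eval,
      HeightOneSpectrum.algebraMap_mem_maximalIdeal_iff]
  obtain ⟨b, hb, hba⟩ := HeightOneSpectrum.exists_isRoot_of_residue v
    ((minpoly.monic hint).map (algebraMap (𝓞 K) (v.adicCompletionIntegers K)))
    (a := algebraMap (𝓞 K) (v.adicCompletionIntegers K) a)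
    (by rw [hmap, ← haeval, minpoly.aeval]; exact zero_mem _)
    (by
      rw [derivative_map, hmap, ← haeval]
      exact fun hc => hdP (Ideal.mem_of_dvd _ hdvd hc))
  have hintK : IsIntegral K (algebraMap (𝓞 M) M θ) := Algebra.IsIntegral.isIntegral _
  let pb := PowerBasis.ofAdjoinEqTop hintK hθ
  have hgen : pb.gen = algebraMap (𝓞 M) M θ := PowerBasis.ofAdjoinEqTop_gen hintK hθ
  have hroot : aeval (b : v.adicCompletion K) (minpoly K pb.gen) = 0 := by
    rw [hgen, minpoly.isIntegrallyClosed_eq_field_fractions K M hint, aeval_map_algebraMap]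
    have h1 := hb.eq_zero
    rw [eval_map_algebraMap] at h1
    have h2 := aeval_algebraMap_apply (v.adicCompletion K) b (minpoly (𝓞 K) θ)
    rw [h1, map_zero] at h2
    exact h2
  let h := pb.lift (b : v.adicCompletion K) hroot
  have hhθ : integerHom h θ = b := by
    ext
    rw [coe_integerHom, ← hgen, PowerBasis.lift_gen]
  refine ⟨h, ?_⟩
  have hle : P.asIdeal ≤ (primeOfAlgHom h).asIdeal := fun x hx => by
    have hdx : algebraMap (𝓞 K) (𝓞 M) d * x ∈ Algebra.adjoin (𝓞 K) {θ} := hcond x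
    rw [Algebra.adjoin_singleton_eq_range_aeval] at hdx
    obtain ⟨q, hq⟩ := hdx
    have hq : aeval θ q = algebraMap (𝓞 K) (𝓞 M) d * x := hq
    have h1 : q.eval a ∈ v.asIdeal := by
      rw [← haeval, hq]
      exact Ideal.mul_mem_left _ _ hx
    rw [← hmap, eval_map_algebraMap] at h1
    have h2 := aeval_sub_mem _ hba q
    have h3 : algebraMap (𝓞 K) (𝓞 M) d * x ∈ (primeOfAlgHom h).asIdeal := by
      rw [mem_primeOfAlgHom_iff, ← hq, integerHom_aeval, hhθ]
      simpa using Ideal.add_mem _ h2 h1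
    refine ((primeOfAlgHom h).isPrime.mem_or_mem h3).resolve_left ?_
    rwa [mem_primeOfAlgHom_iff, integerHom_algebraMap,
      HeightOneSpectrum.algebraMap_mem_maximalIdeal_iff]
  exact HeightOneSpectrum.ext (P.isMaximal.eq_of_le (primeOfAlgHom h).isPrime.ne_top hle).symm

variable (K M) in
theorem exists_ringOfIntegers_adjoin_eq_top :
    ∃ θ : 𝓞 M, Algebra.adjoin K {algebraMap (𝓞 M) M θ} = ⊤ := by
  obtain ⟨α, hα⟩ := Field.exists_primitive_element K M
  have hαalg : IsAlgebraic ℤ α :=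
    (IsFractionRing.isAlgebraic_iff ℤ ℚ M).mpr (Algebra.IsAlgebraic.isAlgebraic α)
  obtain ⟨c, hc, hint⟩ := hαalg.exists_integral_multiple
  obtain ⟨θ, hθα⟩ : ∃ θ : 𝓞 M, algebraMap (𝓞 M) M θ = c • α := ⟨⟨c • α, hint⟩, rfl⟩
  refine ⟨θ, ?_⟩
  rw [← IntermediateField.adjoin_simple_toSubalgebra_of_isAlgebraic
    (Algebra.IsAlgebraic.isAlgebraic _), ← IntermediateField.top_toSubalgebra, ← hα]
  congr 1
  apply le_antisymm
  · rw [IntermediateField.adjoin_simple_le_iff, hθα]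
    exact zsmul_mem (IntermediateField.mem_adjoin_simple_self K α) c
  · rw [IntermediateField.adjoin_simple_le_iff]
    have h1 : algebraMap (𝓞 M) M θ ∈ IntermediateField.adjoin K {algebraMap (𝓞 M) M θ} :=
      IntermediateField.mem_adjoin_simple_self K _
    have h2 : α = (c : M)⁻¹ * algebraMap (𝓞 M) M θ := by
      rw [hθα, zsmul_eq_mul, inv_mul_cancel_left₀ (Int.cast_ne_zero.mpr hc)]
    have h3 := mul_mem (inv_mem (intCast_mem
      (IntermediateField.adjoin K {algebraMap (𝓞 M) M θ}) c)) h1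
    rwa [← h2] at h3

variable (K M) in
theorem exists_ne_zero_forall_card_algHom_eq :
    ∃ d : 𝓞 K, d ≠ 0 ∧ ∀ v : HeightOneSpectrum (𝓞 K), d ∉ v.asIdeal →
      Nat.card (M →ₐ[K] v.adicCompletion K) =
        Nat.card {P : HeightOneSpectrum (𝓞 M) // P.under (𝓞 K) = v ∧ IsDegreeOne K P} := by
  obtain ⟨θ, hθ⟩ := exists_ringOfIntegers_adjoin_eq_top K M
  have hcond : aeval θ (derivative (minpoly (𝓞 K) θ)) ∈ conductor (𝓞 K) θ := by
    have h1 := conductor_mul_differentIdeal (𝓞 K) K M θ hθ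
    have h2 := Ideal.mem_span_singleton_self (aeval θ (derivative (minpoly (𝓞 K) θ)))
    rw [← h1] at h2
    exact Ideal.mul_le_left (I := conductor (𝓞 K) θ) (J := differentIdeal (𝓞 K) (𝓞 M)) h2
  have hne : aeval θ (derivative (minpoly (𝓞 K) θ)) ≠ 0 := by
    intro h0
    have hint : IsIntegral (𝓞 K) θ := Algebra.IsIntegral.isIntegral θ
    have hsep : (minpoly K (algebraMap (𝓞 M) M θ)).Separable :=
      Algebra.IsSeparable.isSeparable K _
    have hne := hsep.aeval_derivative_ne_zero (minpoly.aeval K (algebraMap (𝓞 M) M θ))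
    apply hne
    rw [minpoly.isIntegrallyClosed_eq_field_fractions K M hint, derivative_map,
      aeval_map_algebraMap, aeval_algebraMap_apply, h0, map_zero]
  obtain ⟨d, hd, hdvd⟩ : ∃ d : 𝓞 K, d ≠ 0 ∧
      aeval θ (derivative (minpoly (𝓞 K) θ)) ∣ algebraMap (𝓞 K) (𝓞 M) d := by
    have := Ideal.comap_ne_bot_of_integral_mem (R := 𝓞 K) hne
      (Ideal.mem_span_singleton_self _) (Algebra.IsIntegral.isIntegral _)
    obtain ⟨d, hd, hd0⟩ := Submodule.exists_mem_ne_zero_of_ne_bot this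
    exact ⟨d, hd0, Ideal.mem_span_singleton.mp hd⟩
  have hdcond : algebraMap (𝓞 K) (𝓞 M) d ∈ conductor (𝓞 K) θ := Ideal.mem_of_dvd _ hdvd hcond
  refine ⟨d, hd, fun v hv => ?_⟩
  refine Nat.card_eq_of_bijective
    (fun h => ⟨primeOfAlgHom h, under_primeOfAlgHom h, isDegreeOne_primeOfAlgHom h⟩) ⟨?_, ?_⟩
  · intro h h' hh
    exact algHom_eq_of_primeOfAlgHom_eq hθ hv hdvd (congrArg Subtype.val hh)
  · rintro ⟨P, hP, hP1⟩
    obtain ⟨h, hh⟩ := exists_primeOfAlgHom_eq hθ hv hdvd hdcond hP hP1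
    exact ⟨h, Subtype.ext hh⟩

end LocalEmbeddings

section PrimesAbove

variable {K : Type*} [Field K] {M : Type*} [Field M] [Algebra K M]

/-- Primes of `M` lying over a given prime of `K`, as ideals. -/
def fiberToPrimesOver (v : HeightOneSpectrum (𝓞 K))
    (P : {P : HeightOneSpectrum (𝓞 M) // P.under (𝓞 K) = v}) : v.asIdeal.primesOver (𝓞 M) :=
  ⟨P.1.asIdeal, P.1.isPrime, ⟨(congrArg HeightOneSpectrum.asIdeal P.2).symm⟩⟩

theorem fiberToPrimesOver_injective (v : HeightOneSpectrum (𝓞 K)) :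
    Function.Injective (fiberToPrimesOver (M := M) v) := fun _ _ h =>
  Subtype.ext (HeightOneSpectrum.ext (congrArg Subtype.val h))

variable [NumberField K] [NumberField M]

instance finite_fiber_under (v : HeightOneSpectrum (𝓞 K)) :
    Finite {P : HeightOneSpectrum (𝓞 M) // P.under (𝓞 K) = v} :=
  have := v.isMaximal
  Finite.of_injective _ (fiberToPrimesOver_injective v)

theorem card_fiber_under_le (v : HeightOneSpectrum (𝓞 K)) :
    Nat.card {P : HeightOneSpectrum (𝓞 M) // P.under (𝓞 K) = v} ≤ Module.finrank (𝓞 K) (𝓞 M) := by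
  have := v.isMaximal
  have := Fintype.ofFinite (v.asIdeal.primesOver (𝓞 M))
  refine (Nat.card_le_card_of_injective _ (fiberToPrimesOver_injective v)).trans ?_
  rw [← Ideal.sum_ramification_inertia_eq_finrank v.asIdeal (𝓞 M), Nat.card_eq_fintype_card,
    ← Finset.card_univ, Finset.card_eq_sum_ones]
  refine Finset.sum_le_sum fun q _ => Nat.one_le_iff_ne_zero.mpr (mul_ne_zero ?_ ?_)
  · exact (q.1.ramificationIdx_pos (𝓞 K)).ne'
  · exact (q.1.inertiaDeg_pos (𝓞 K)).ne'

theorem exists_absNorm_eq_pow (P : HeightOneSpectrum (𝓞 M)) :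
    ∃ k ≠ 0, Ideal.absNorm P.asIdeal = Ideal.absNorm (P.under (𝓞 K)).asIdeal ^ k := by
  have : P.asIdeal.LiesOver (P.under (𝓞 K)).asIdeal := ⟨rfl⟩
  refine ⟨_, ?_, Ideal.absNorm_eq_pow_inertiaDeg'_of_liesOver P.asIdeal (P.under (𝓞 K)).asIdeal
    (P.under (𝓞 K)).isPrime (P.under (𝓞 K)).ne_bot⟩
  have := (P.under (𝓞 K)).isMaximal
  exact Ideal.inertiaDeg'_ne_zero _ _

theorem absNorm_under_eq_iff_isDegreeOne (P : HeightOneSpectrum (𝓞 M)) :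
    Ideal.absNorm P.asIdeal = Ideal.absNorm (P.under (𝓞 K)).asIdeal ↔ IsDegreeOne K P := by
  have hl : P.asIdeal.LiesOver (P.under (𝓞 K)).asIdeal := ⟨rfl⟩
  let φ := algebraMap (𝓞 K ⧸ (P.under (𝓞 K)).asIdeal) (𝓞 M ⧸ P.asIdeal)
  have : Finite (𝓞 K ⧸ (P.under (𝓞 K)).asIdeal) :=
    Ideal.finiteQuotientOfFreeOfNeBot _ (P.under (𝓞 K)).ne_bot
  have : Finite (𝓞 M ⧸ P.asIdeal) := Ideal.finiteQuotientOfFreeOfNeBot _ P.ne_bot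
  have hinj : Function.Injective φ := FaithfulSMul.algebraMap_injective _ _
  have hsurj : Function.Surjective φ ↔ IsDegreeOne K P := by
    constructor
    · intro h x
      obtain ⟨y, hy⟩ := h (Ideal.Quotient.mk _ x)
      obtain ⟨a, rfl⟩ := Ideal.Quotient.mk_surjective y
      exact ⟨a, Ideal.Quotient.eq.mp hy.symm⟩
    · intro h y
      obtain ⟨x, rfl⟩ := Ideal.Quotient.mk_surjective y
      obtain ⟨a, ha⟩ := h x
      exact ⟨Ideal.Quotient.mk _ a, (Ideal.Quotient.eq.mpr ha).symm⟩
  rw [← hsurj, Ideal.absNorm_apply, Ideal.absNorm_apply, Submodule.cardQuot_apply,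
    Submodule.cardQuot_apply]
  constructor
  · intro h
    exact (Nat.bijective_iff_injective_and_card _ |>.mpr ⟨hinj, h.symm⟩).2
  · intro h
    exact (Nat.card_eq_of_bijective φ ⟨hinj, h⟩).symm

end PrimesAbove

section Average

variable (K : Type*) [Field K] [NumberField K]

/-- `g` has average `a` over the primes of `K`, in the sense of Dirichlet. -/
structure HasAverage (g : HeightOneSpectrum (𝓞 K) → ℝ) (a : ℝ) : Prop where
  summable : ∀ s : ℝ, 1 < s → Summable fun v => g v * (Ideal.absNorm v.asIdeal : ℝ) ^ (-s)
  tendsto : Tendsto (fun s : ℝ =>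
      (∑' v, g v * (Ideal.absNorm v.asIdeal : ℝ) ^ (-s)) / (-Real.log (s - 1)))
    (nhdsWithin 1 (Set.Ioi 1)) (nhds a)

variable (M : Type*) [Field M] [NumberField M] [Algebra K M]

theorem hasSum_card_isDegreeOne {s : ℝ} (hs : 1 < s) :
    HasSum (fun v : HeightOneSpectrum (𝓞 K) =>
      (Nat.card {P : HeightOneSpectrum (𝓞 M) // P.under (𝓞 K) = v ∧ IsDegreeOne K P} : ℝ) *
        (Ideal.absNorm v.asIdeal : ℝ) ^ (-s))
      (∑' P : {P : HeightOneSpectrum (𝓞 M) // IsDegreeOne K P},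
        (Ideal.absNorm P.1.asIdeal : ℝ) ^ (-s)) := by
  have h := (((HeightOneSpectrum.summable_absNorm_rpow_of_one_lt M hs).subtype
    {P | IsDegreeOne K P}).hasSum).tsum_fiberwise (fun P => P.1.under (𝓞 K))
  refine HasSum.congr_fun h fun v => ?_
  have hterm (P : (fun P : {P : HeightOneSpectrum (𝓞 M) // IsDegreeOne K P} =>
      P.1.under (𝓞 K)) ⁻¹' {v}) :
      (Ideal.absNorm P.1.1.asIdeal : ℝ) ^ (-s) = (Ideal.absNorm v.asIdeal : ℝ) ^ (-s) := by
    have h1 := (absNorm_under_eq_iff_isDegreeOne P.1.1).mpr P.1.2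
    have h2 : P.1.1.under (𝓞 K) = v := P.2
    rw [h2] at h1
    rw [h1]
  symm
  refine (tsum_congr hterm).trans ((tsum_const _).trans ((nsmul_eq_mul _ _).trans ?_))
  congr 2
  exact Nat.card_congr ⟨fun P => ⟨P.1.1, P.2, P.1.2⟩, fun P => ⟨⟨P.1, P.2.2⟩, P.2.1⟩,
    fun _ => rfl, fun _ => rfl⟩

theorem summable_absNorm_under_rpow {s : ℝ} (hs : 1 < s) :
    Summable fun P : HeightOneSpectrum (𝓞 M) =>
      (Ideal.absNorm (P.under (𝓞 K)).asIdeal : ℝ) ^ (-s) := by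
  rw [← (Equiv.sigmaFiberEquiv fun P : HeightOneSpectrum (𝓞 M) => P.under (𝓞 K)).summable_iff,
    summable_sigma_of_nonneg]
  swap
  · exact fun _ => Real.rpow_nonneg (Nat.cast_nonneg _) _
  refine ⟨fun v => Summable.of_finite, ?_⟩
  refine Summable.of_nonneg_of_le (fun v => tsum_nonneg fun _ =>
    Real.rpow_nonneg (Nat.cast_nonneg _) _) (fun v => ?_)
    ((HeightOneSpectrum.summable_absNorm_rpow_of_one_lt K hs).mul_left
      (Module.finrank (𝓞 K) (𝓞 M) : ℝ))
  have hterm (P : {P : HeightOneSpectrum (𝓞 M) // P.under (𝓞 K) = v}) :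
      (Ideal.absNorm (P.1.under (𝓞 K)).asIdeal : ℝ) ^ (-s) =
        (Ideal.absNorm v.asIdeal : ℝ) ^ (-s) := by rw [P.2]
  refine (tsum_congr hterm).trans_le ?_
  rw [tsum_const, nsmul_eq_mul]
  exact mul_le_mul_of_nonneg_right (Nat.cast_le.mpr (card_fiber_under_le v))
    (Real.rpow_nonneg (Nat.cast_nonneg _) _)

variable {K M} in
theorem absNorm_rpow_le_of_not_isDegreeOne {P : HeightOneSpectrum (𝓞 M)}
    (hP : ¬ IsDegreeOne K P) {s : ℝ} (hs : 1 ≤ s) :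
    (Ideal.absNorm P.asIdeal : ℝ) ^ (-s) ≤
      (Ideal.absNorm (P.under (𝓞 K)).asIdeal : ℝ) ^ (-2 : ℝ) := by
  obtain ⟨k, hk, hPk⟩ := exists_absNorm_eq_pow (K := K) P
  have hk1 : k ≠ 1 := fun h => hP ((absNorm_under_eq_iff_isDegreeOne P).mp (by simpa [h] using hPk))
  have hk2 : (2 : ℝ) ≤ k := by exact_mod_cast (by omega : 2 ≤ k)
  have h1 : (1 : ℝ) ≤ Ideal.absNorm (P.under (𝓞 K)).asIdeal :=
    mod_cast (NumberField.HeightOneSpectrum.one_lt_absNorm _).le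
  rw [hPk, Nat.cast_pow, ← Real.rpow_natCast, ← Real.rpow_mul (by linarith)]
  exact Real.rpow_le_rpow_of_exponent_le h1 (by nlinarith)

theorem hasAverage_card_algHom :
    HasAverage K (fun v => (Nat.card (M →ₐ[K] v.adicCompletion K) : ℝ)) 1 := by
  obtain ⟨d, hd, hcard⟩ := exists_ne_zero_forall_card_algHom_eq K M
  have hfin : {v : HeightOneSpectrum (𝓞 K) | d ∈ v.asIdeal}.Finite := by
    have := Ideal.finite_factors (I := Ideal.span {d}) (by simpa using hd)
    simpa [Ideal.dvd_span_singleton] using this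
  let c (v : HeightOneSpectrum (𝓞 K)) : ℝ :=
    Nat.card {P : HeightOneSpectrum (𝓞 M) // P.under (𝓞 K) = v ∧ IsDegreeOne K P}
  let g (v : HeightOneSpectrum (𝓞 K)) : ℝ := Nat.card (M →ₐ[K] v.adicCompletion K)
  have hN (v : HeightOneSpectrum (𝓞 K)) {s : ℝ} (hs : 1 < s) :
      (Ideal.absNorm v.asIdeal : ℝ) ^ (-s) ≤ 1 := by
    linarith [absNorm_rpow_le_half hs.le v]
  have hdiff (s : ℝ) : HasSum (fun v => (g v - c v) * (Ideal.absNorm v.asIdeal : ℝ) ^ (-s))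
      (∑ v ∈ hfin.toFinset, (g v - c v) * (Ideal.absNorm v.asIdeal : ℝ) ^ (-s)) := by
    refine hasSum_sum_of_ne_finset_zero fun v hv => ?_
    have hv : d ∉ v.asIdeal := by simpa using hv
    simp only [g, c, hcard v hv, sub_self, zero_mul]
  have hg {s : ℝ} (hs : 1 < s) :
      HasSum (fun v => g v * (Ideal.absNorm v.asIdeal : ℝ) ^ (-s)) _ :=
    ((hasSum_card_isDegreeOne K M hs).add (hdiff s)).congr_fun fun v => by ring
  refine ⟨fun s hs => (hg hs).summable, ?_⟩
  refine tendsto_div_neg_log_of_abs_sub_le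
    (C := ∑ v ∈ hfin.toFinset, |g v - c v| +
      ∑' P : HeightOneSpectrum (𝓞 M), (Ideal.absNorm (P.under (𝓞 K)).asIdeal : ℝ) ^ (-2 : ℝ))
    (tendsto_tsum_absNorm_div_neg_log M) ?_
  filter_upwards [self_mem_nhdsWithin] with s hs
  have hs : 1 < s := hs
  have hsumM := HeightOneSpectrum.summable_absNorm_rpow_of_one_lt M hs
  have hsplit : ∑' P : {P : HeightOneSpectrum (𝓞 M) // IsDegreeOne K P},
        (Ideal.absNorm P.1.asIdeal : ℝ) ^ (-s) +
      ∑' P : ({P : HeightOneSpectrum (𝓞 M) | IsDegreeOne K P}ᶜ : Set _),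
        (Ideal.absNorm P.1.asIdeal : ℝ) ^ (-s) = _ :=
    hsumM.tsum_subtype_add_tsum_subtype_compl {P | IsDegreeOne K P}
  have hrest : |∑' P : ({P : HeightOneSpectrum (𝓞 M) | IsDegreeOne K P}ᶜ : Set _),
      (Ideal.absNorm P.1.asIdeal : ℝ) ^ (-s)| ≤
      ∑' P : HeightOneSpectrum (𝓞 M), (Ideal.absNorm (P.under (𝓞 K)).asIdeal : ℝ) ^ (-2 : ℝ) := by
    have hsum2 := summable_absNorm_under_rpow K M (s := 2) (by norm_num)
    rw [abs_of_nonneg (tsum_nonneg fun _ => Real.rpow_nonneg (Nat.cast_nonneg _) _)]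
    refine (Summable.tsum_le_tsum (fun P => absNorm_rpow_le_of_not_isDegreeOne P.2 hs.le)
      (hsumM.subtype _) (hsum2.subtype _)).trans ?_
    exact hsum2.tsum_subtype_le _ _ (fun _ => Real.rpow_nonneg (Nat.cast_nonneg _) _)
  have hbad : |∑ v ∈ hfin.toFinset, (g v - c v) * (Ideal.absNorm v.asIdeal : ℝ) ^ (-s)| ≤
      ∑ v ∈ hfin.toFinset, |g v - c v| := by
    refine (Finset.abs_sum_le_sum_abs _ _).trans (Finset.sum_le_sum fun v _ => ?_)
    rw [abs_mul, abs_of_nonneg (Real.rpow_nonneg (Nat.cast_nonneg _) _)]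
    exact mul_le_of_le_one_right (abs_nonneg _) (hN v hs)
  rw [(hg hs).tsum_eq, ← hsplit]
  refine le_trans (le_of_eq ?_) ((abs_sub _ _).trans (add_le_add hbad hrest))
  congr 1
  rw [add_sub_add_left_eq_sub]

variable {K}

theorem HasAverage.sum {ι : Type*} (I : Finset ι) {g : ι → HeightOneSpectrum (𝓞 K) → ℝ}
    {a : ι → ℝ} (h : ∀ i ∈ I, HasAverage K (g i) (a i)) :
    HasAverage K (fun v => ∑ i ∈ I, g i v) (∑ i ∈ I, a i) where
  summable s hs := by
    simp_rw [Finset.sum_mul]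
    exact summable_sum fun i hi => (h i hi).summable s hs
  tendsto := by
    refine (tendsto_finsetSum I fun i hi => (h i hi).tendsto).congr' ?_
    filter_upwards [self_mem_nhdsWithin] with s hs
    simp_rw [Finset.sum_mul]
    rw [Summable.tsum_finsetSum fun i hi => (h i hi).summable s hs, Finset.sum_div]

theorem HasAverage.add {g g' : HeightOneSpectrum (𝓞 K) → ℝ} {a a' : ℝ}
    (h : HasAverage K g a) (h' : HasAverage K g' a') :
    HasAverage K (fun v => g v + g' v) (a + a') := by
  simpa using HasAverage.sum (Finset.univ : Finset (Fin 2)) (g := ![g, g']) (a := ![a, a'])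
    (by simp [Fin.forall_fin_two, h, h'])

theorem HasAverage.const_mul {g : HeightOneSpectrum (𝓞 K) → ℝ} {a : ℝ} (c : ℝ)
    (h : HasAverage K g a) : HasAverage K (fun v => c * g v) (c * a) where
  summable s hs := by
    simp_rw [mul_assoc]
    exact (h.summable s hs).mul_left c
  tendsto := by
    simp_rw [mul_assoc, tsum_mul_left, mul_div_assoc]
    exact h.tendsto.const_mul c

theorem HasAverage.mono {g g' : HeightOneSpectrum (𝓞 K) → ℝ} {a a' : ℝ}
    (h : HasAverage K g a) (h' : HasAverage K g' a') (hle : ∀ v, g v ≤ g' v) : a ≤ a' := by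
  refine le_of_tendsto_of_tendsto h.tendsto h'.tendsto ?_
  filter_upwards [self_mem_nhdsWithin,
    tendsto_neg_log_sub_one_atTop.eventually_gt_atTop 0] with s hs hlog
  refine div_le_div_of_nonneg_right (Summable.tsum_le_tsum (fun v => ?_) (h.summable s hs)
    (h'.summable s hs)) hlog.le
  exact mul_le_mul_of_nonneg_right (hle v) (Real.rpow_nonneg (Nat.cast_nonneg _) _)

end Average

section FiniteAlgebras

universe u

section Field

variable {K : Type u} [Field K] {A : Type*} [CommRing A] [Algebra K A] (L : Type*) [Field L]
  [Algebra K L]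

theorem bijective_sigma_algHom_quotient [IsArtinianRing A] :
    Function.Bijective fun x : (Σ m : MaximalSpectrum A, (A ⧸ m.asIdeal) →ₐ[K] L) =>
      x.2.comp (Ideal.Quotient.mkₐ K x.1.asIdeal) := by
  have hker (m : MaximalSpectrum A) (ψ : (A ⧸ m.asIdeal) →ₐ[K] L) :
      RingHom.ker (ψ.comp (Ideal.Quotient.mkₐ K m.asIdeal)) = m.asIdeal := by
    have := m.isMaximal
    let := Ideal.Quotient.field m.asIdeal
    ext a
    rw [RingHom.mem_ker, AlgHom.comp_apply, map_eq_zero_iff ψ ψ.toRingHom.injective,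
      Ideal.Quotient.mkₐ_eq_mk, Ideal.Quotient.eq_zero_iff_mem]
  constructor
  · rintro ⟨m, ψ⟩ ⟨m', ψ'⟩ h
    obtain rfl : m = m' := MaximalSpectrum.ext (by
      rw [← hker m ψ, ← hker m' ψ']
      exact congrArg (fun f : A →ₐ[K] L => RingHom.ker f) h)
    exact congrArg _ (Ideal.Quotient.algHom_ext K h)
  · intro f
    have := RingHom.ker_isPrime f
    exact ⟨⟨⟨RingHom.ker f, inferInstance⟩, Ideal.Quotient.liftₐ _ f fun _ h => h⟩,
      AlgHom.ext fun _ => rfl⟩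

theorem card_algHom_eq_sum [Module.Finite K A] [IsArtinianRing A] [Fintype (MaximalSpectrum A)] :
    Nat.card (A →ₐ[K] L) =
      ∑ m : MaximalSpectrum A, Nat.card ((A ⧸ m.asIdeal) →ₐ[K] L) := by
  rw [← Nat.card_eq_of_bijective _ (bijective_sigma_algHom_quotient L), Nat.card_sigma]

theorem card_algHom_tensorProduct (B : Type*) [CommRing B] [Algebra K B] :
    Nat.card (TensorProduct K A B →ₐ[K] L) = Nat.card (A →ₐ[K] L) * Nat.card (B →ₐ[K] L) := by
  rw [← Nat.card_prod]
  exact Nat.card_congr (Algebra.TensorProduct.liftEquiv.symm.trans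
    (Equiv.subtypeUnivEquiv fun _ _ _ => Commute.all _ _))

variable (K) in
theorem exists_algebra_card_algHom_eq_pow (M : Type u) [CommRing M] [Algebra K M]
    [Module.Finite K M] (k : ℕ) :
    ∃ (A : Type u) (_ : CommRing A) (_ : Algebra K A), Module.Finite K A ∧
      ∀ (L : Type u) [Field L] [Algebra K L],
        Nat.card (A →ₐ[K] L) = Nat.card (M →ₐ[K] L) ^ k := by
  induction k with
  | zero => exact ⟨K, inferInstance, inferInstance, inferInstance, fun L _ _ => by simp⟩
  | succ k ih =>
    obtain ⟨A, _, _, _, h⟩ := ih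
    exact ⟨TensorProduct K A M, inferInstance, inferInstance, inferInstance, fun L _ _ => by
      rw [card_algHom_tensorProduct, h, pow_succ]⟩

variable (K) in
theorem one_lt_card_maximalSpectrum_tensorProduct (M : Type*) [Field M] [Algebra K M]
    [Module.Finite K M] [Algebra.IsSeparable K M] (hM : 1 < Module.finrank K M) :
    1 < Nat.card (MaximalSpectrum (TensorProduct K M M)) := by
  have : IsArtinianRing (TensorProduct K M M) := IsArtinianRing.of_finite K _
  have hcard := AlgHom.card K M (AlgebraicClosure K)
  rw [← hcard, Fintype.one_lt_card_iff] at hM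
  obtain ⟨σ, τ, hne⟩ := hM
  let f : TensorProduct K M M →ₐ[K] AlgebraicClosure K :=
    Algebra.TensorProduct.lift σ τ fun _ _ => Commute.all _ _
  let g : TensorProduct K M M →ₐ[K] M := Algebra.TensorProduct.lmul' K
  have := RingHom.ker_isPrime f
  have := RingHom.ker_isPrime g
  rw [Finite.one_lt_card_iff_nontrivial]
  refine ⟨⟨RingHom.ker f, inferInstance⟩, ⟨RingHom.ker g, inferInstance⟩, fun h => hne ?_⟩
  ext x
  have h' : RingHom.ker f = RingHom.ker g := congrArg MaximalSpectrum.asIdeal h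
  have hx : TensorProduct.tmul K x 1 - TensorProduct.tmul K 1 x ∈ RingHom.ker f := by
    rw [h', RingHom.mem_ker]
    simp [g]
  rw [RingHom.mem_ker] at hx
  simpa [f, sub_eq_zero] using hx

end Field

variable {K : Type u} [Field K] [NumberField K]

theorem hasAverage_card_algHom_of_finite (A : Type*) [CommRing A] [Algebra K A]
    [Module.Finite K A] :
    HasAverage K (fun v => (Nat.card (A →ₐ[K] v.adicCompletion K) : ℝ))
      (Nat.card (MaximalSpectrum A)) := by
  have : IsArtinianRing A := IsArtinianRing.of_finite K A
  have := Fintype.ofFinite (MaximalSpectrum A)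
  have h := HasAverage.sum (K := K) Finset.univ
    (g := fun (m : MaximalSpectrum A) v =>
      (Nat.card ((A ⧸ m.asIdeal) →ₐ[K] v.adicCompletion K) : ℝ)) (a := fun _ => 1) fun m _ => by
    have := m.isMaximal
    let := Ideal.Quotient.field m.asIdeal
    have := NumberField.of_module_finite K (A ⧸ m.asIdeal)
    exact hasAverage_card_algHom K (A ⧸ m.asIdeal)
  rw [Finset.sum_const, Finset.card_univ, nsmul_one, ← Nat.card_eq_fintype_card] at h
  simp_rw [card_algHom_eq_sum, Nat.cast_sum]
  exact h

theorem exists_hasAverage_card_algHom_pow (M : Type u) [CommRing M] [Algebra K M]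
    [Module.Finite K M] (k : ℕ) :
    ∃ a, HasAverage K (fun v => (Nat.card (M →ₐ[K] v.adicCompletion K) : ℝ) ^ k) a := by
  obtain ⟨A, _, _, _, h⟩ := exists_algebra_card_algHom_eq_pow K M k
  refine ⟨Nat.card (MaximalSpectrum A), ?_⟩
  simp_rw [← Nat.cast_pow, ← h]
  exact hasAverage_card_algHom_of_finite A

theorem exists_hasAverage_card_algHom_sq (M : Type*) [Field M] [Algebra K M]
    [Module.Finite K M] (hM : 1 < Module.finrank K M) :
    ∃ a : ℝ, 1 < a ∧
      HasAverage K (fun v => (Nat.card (M →ₐ[K] v.adicCompletion K) : ℝ) ^ 2) a := by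
  refine ⟨_, Nat.one_lt_cast.mpr (one_lt_card_maximalSpectrum_tensorProduct K M hM), ?_⟩
  simp_rw [sq, ← Nat.cast_mul, ← card_algHom_tensorProduct]
  exact hasAverage_card_algHom_of_finite _

end FiniteAlgebras

section Indicator

variable {K : Type*} [Field K] [NumberField K]

theorem HasAverage.hasDirichletDensity {S : Set (HeightOneSpectrum (𝓞 K))} {δ : ℝ}
    (h : HasAverage K (S.indicator 1) δ) : HasDirichletDensity K S δ := by
  refine h.tendsto.congr fun s => ?_
  rw [tsum_subtype S fun v => (Ideal.absNorm v.asIdeal : ℝ) ^ (-s)]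
  congr 1
  refine tsum_congr fun v => ?_
  by_cases hv : v ∈ S <;> simp [hv]

theorem exists_hasAverage_indicator_of_pow {g : HeightOneSpectrum (𝓞 K) → ℕ} {n : ℕ}
    (hn : ∀ v, g v ≤ n) (h : ∀ k : ℕ, ∃ a, HasAverage K (fun v => (g v : ℝ) ^ k) a) :
    ∃ δ, HasAverage K ({v | g v ≠ 0}.indicator 1) δ := by
  choose a ha using h
  let Q : ℝ[X] := Lagrange.interpolate (Finset.range (n + 1)) (fun i : ℕ => (i : ℝ))
    fun i => if i = 0 then 0 else 1
  have hQ (v : HeightOneSpectrum (𝓞 K)) :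
      {v | g v ≠ 0}.indicator 1 v = ∑ k ∈ Finset.range (Q.natDegree + 1),
        Q.coeff k * (g v : ℝ) ^ k := by
    rw [← Polynomial.eval_eq_sum_range, Lagrange.eval_interpolate_at_node _
      Nat.cast_injective.injOn (Finset.mem_range_succ_iff.mpr (hn v))]
    by_cases hv : g v = 0 <;> simp [hv]
  refine ⟨_, funext hQ ▸ HasAverage.sum _ fun k _ => (ha k).const_mul (Q.coeff k)⟩

end Indicator

/-- If `F ∈ K[x]` is irreducible of degree `> 1`, then the set of primes `𝔭` of `K` such
that `F` has a root in `K_𝔭` has Dirichlet density strictly less than `1`. -/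
theorem stmt_8 {K : Type*} [Field K] [NumberField K] (F : K[X])
    (hF : Irreducible F) (hdeg : 1 < F.natDegree) :
    ∃ δ : ℝ, HasDirichletDensity K
        {v : HeightOneSpectrum (𝓞 K) | ∃ x : v.adicCompletion K, aeval x F = 0} δ ∧
      δ < 1 := by
  have : Fact (Irreducible F) := ⟨hF⟩
  have : Module.Finite K (AdjoinRoot F) := (AdjoinRoot.powerBasis hF.ne_zero).finite
  have hrank : Module.finrank K (AdjoinRoot F) = F.natDegree := by
    rw [(AdjoinRoot.powerBasis hF.ne_zero).finrank, AdjoinRoot.powerBasis_dim]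
  let n := F.natDegree
  let g (v : HeightOneSpectrum (𝓞 K)) : ℕ := Nat.card (AdjoinRoot F →ₐ[K] v.adicCompletion K)
  have hg (v : HeightOneSpectrum (𝓞 K)) : g v ≤ n :=
    (card_algHom_le_finrank K (AdjoinRoot F) _).trans_eq hrank
  have hS : {v : HeightOneSpectrum (𝓞 K) | ∃ x : v.adicCompletion K, aeval x F = 0} =
      {v | g v ≠ 0} := by
    ext v
    refine Iff.trans ?_ (Nat.card_ne_zero.trans (and_iff_left (Finite.algHom K _ _))).symm
    exact ⟨fun ⟨x, hx⟩ => ⟨AdjoinRoot.liftAlgHom F (Algebra.ofId K _) x hx⟩,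
      fun ⟨φ⟩ => ⟨φ (AdjoinRoot.root F), AdjoinRoot.aeval_algHom_eq_zero F φ⟩⟩
  obtain ⟨δ, hδ⟩ := exists_hasAverage_indicator_of_pow hg
    (exists_hasAverage_card_algHom_pow (AdjoinRoot F))
  have : NumberField (AdjoinRoot F) := NumberField.of_module_finite K _
  obtain ⟨a, ha, hsq⟩ := exists_hasAverage_card_algHom_sq (AdjoinRoot F) (hrank ▸ hdeg)
  have hone := hasAverage_card_algHom K (AdjoinRoot F)
  rw [hS]
  refine ⟨δ, hδ.hasDirichletDensity, ?_⟩
  have hn : (0 : ℝ) < n := by exact_mod_cast (zero_lt_one.trans hdeg)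
  have hle : n * δ + a ≤ (n + 1) * 1 := by
    refine HasAverage.mono (HasAverage.add (hδ.const_mul (n : ℝ)) hsq)
      (hone.const_mul ((n : ℝ) + 1)) fun v => ?_
    change (n : ℝ) * {v | g v ≠ 0}.indicator 1 v + (g v : ℝ) ^ 2 ≤ (n + 1) * (g v : ℝ)
    by_cases hv : g v = 0
    · simp [hv]
    · have h1 : (1 : ℝ) ≤ g v := by exact_mod_cast Nat.one_le_iff_ne_zero.mpr hv
      have h2 : (g v : ℝ) ≤ n := by exact_mod_cast hg v
      rw [Set.indicator_of_mem (by exact hv), Pi.one_apply]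
      nlinarith
  nlinarith
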